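/- For every positive integer M there exist prime powers q and q', both powers of 2, with q < q' and q' − q ≥ M, an integer ω ≥ 3, and a tuple (d_1, …, d_ω) of integers each at least 2, such that: (d_1, …, d_ω) is realizable over the field of order q; it is not realizable over any finite field of order less than q; it is not realizable over the field of order q'; and it is realizable over every finite field of order greater than q'. In other words, there are multicast networks for which both q_min and q*_max are even prime powers and the gap q*_max − q_min exceeds M. -/

import Mathlib

/-- `Realizable F ω d` : there are subsets `S i ⊆ F \ {0}` with `|S i| = d i` such that
`(-1)^(ω-1)` is not in the product set `S 1 ⋯ S ω`. -/
def Realizable (F : Type*) [Field F] (ω : ℕ) (d : Fin ω → ℕ) : Prop :=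
  ∃ S : Fin ω → Finset F,
    (∀ i, (0 : F) ∉ S i) ∧ (∀ i, (S i).card = d i) ∧
    ∀ a : Fin ω → F, (∀ i, a i ∈ S i) → (-1 : F) ^ (ω - 1) ≠ ∏ i, a i

open scoped Pointwise

section Kneser
set_option linter.unusedSectionVars false
variable {G : Type*} [CommGroup G] [Finite G]

def KP (A B : Set G) : Prop :=
  ∃ H : Subgroup G, A * B * (H : Set G) = A * B ∧
    (A * (H : Set G)).ncard + (B * (H : Set G)).ncard ≤ (A * B).ncard + Nat.card H

def KLess (A' B' A B : Set G) : Prop :=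
  (A' * B').ncard < (A * B).ncard ∨
  ((A' * B').ncard = (A * B).ncard ∧ A.ncard + B.ncard < A'.ncard + B'.ncard) ∨
  ((A' * B').ncard = (A * B).ncard ∧ A.ncard + B.ncard = A'.ncard + B'.ncard ∧
    A'.ncard < A.ncard)

lemma subset_mul_sub (A : Set G) (H : Subgroup G) : A ⊆ A * (H : Set G) :=
  fun a ha => ⟨a, ha, 1, H.one_mem, mul_one a⟩

lemma sub_mul_sub (H : Subgroup G) : (H : Set G) * (H : Set G) = H := by
  simp

lemma ncard_smul_sub (a : G) (H : Subgroup G) : (a • (H : Set G)).ncard = Nat.card H := by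
  rw [Set.ncard_smul_set]; rfl

lemma mem_coset {a x : G} {H : Subgroup G} : x ∈ a • (H : Set G) ↔ a⁻¹ * x ∈ H := by
  rw [Set.mem_smul_set_iff_inv_smul_mem]; rfl

/-- The part of a coset missed by `U*H`. -/
lemma coset_part (A B : Set G) (K H : Subgroup G) (hHK : H ≤ K) (c : G) :
    Nat.card K ≤ ((c • (K : Set G)) \ ((A ∪ B) * (H : Set G))).ncard +
      ((A ∩ c • (K : Set G)) * (H : Set G)).ncard + ((B ∩ c • (K : Set G)) * (H : Set G)).ncard := by
  rw [← ncard_smul_sub c K]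
  have : c • (K : Set G) ⊆ (((c • (K : Set G)) \ ((A ∪ B) * (H : Set G))) ∪
      ((A ∩ c • (K : Set G)) * (H : Set G))) ∪ ((B ∩ c • (K : Set G)) * (H : Set G)) := by
    intro x hx
    by_cases h : x ∈ (A ∪ B) * (H : Set G)
    · obtain ⟨u, hu, y, hy, rfl⟩ := h
      have hu' : u ∈ c • (K : Set G) := by
        rw [mem_coset] at hx ⊢
        have := K.mul_mem hx (K.inv_mem (hHK hy))
        simpa [mul_assoc] using this
      rcases hu with hu | hu
      · exact Or.inl (Or.inr ⟨u, ⟨hu, hu'⟩, y, hy, rfl⟩)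
      · exact Or.inr ⟨u, ⟨hu, hu'⟩, y, hy, rfl⟩
    · exact Or.inl (Or.inl ⟨hx, h⟩)
  have h1 := Set.ncard_le_ncard this
  have h2 := Set.ncard_union_le (((c • (K : Set G)) \ ((A ∪ B) * (H : Set G))) ∪
      ((A ∩ c • (K : Set G)) * (H : Set G))) ((B ∩ c • (K : Set G)) * (H : Set G))
  have h3 := Set.ncard_union_le ((c • (K : Set G)) \ ((A ∪ B) * (H : Set G)))
      ((A ∩ c • (K : Set G)) * (H : Set G))
  omega

lemma coset_sub {U : Set G} {K : Subgroup G} {a : G} (ha : a ∈ U) :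
    a • (K : Set G) ⊆ U * (K : Set G) := by
  rintro _ ⟨k, hk, rfl⟩; exact ⟨a, ha, k, hk, rfl⟩

lemma period_props {D AB : Set G} {K H : Subgroup G} {z w : G} (hD : D.Nonempty)
    (hDz : D ⊆ z • (K : Set G)) (hDH : D * (H : Set G) = D) (hDA : D ⊆ AB)
    (hw : w ∈ z • (K : Set G)) (hwA : w ∉ AB) : H ≤ K ∧ Nat.card H < Nat.card K := by
  obtain ⟨d, hd⟩ := hD
  have hle : H ≤ K := by
    intro x hx
    have h1 : d * x ∈ D := hDH ▸ ⟨d, hd, x, hx, rfl⟩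
    have h2 := mem_coset.1 (hDz h1)
    have h3 := mem_coset.1 (hDz hd)
    have := K.mul_mem (K.inv_mem h3) h2
    simpa [mul_assoc] using this
  refine ⟨hle, ?_⟩
  refine lt_of_le_of_ne (Nat.card_mono (Set.toFinite _) hle) ?_
  intro heq
  have hHK : H = K := SetLike.coe_injective (Set.eq_of_subset_of_ncard_le hle heq.ge)
  subst hHK
  apply hwA
  apply hDA
  have h3 := mem_coset.1 (hDz hd)
  have h4 := mem_coset.1 hw
  rw [← hDH]
  refine ⟨d, hd, d⁻¹ * w, ?_, by simp⟩
  have := H.mul_mem (H.inv_mem h3) h4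
  simpa [mul_assoc] using this

lemma kneser_core (A B : Set G) (hI : (A ∩ B).Nonempty) (hne : ¬ A ⊆ B)
    (ih : ∀ A' B' : Set G, A'.Nonempty → B'.Nonempty → KLess A' B' A B → KP A' B') : KP A B := by
  classical
  have hA : A.Nonempty := hI.mono Set.inter_subset_left
  have hB : B.Nonempty := hI.mono Set.inter_subset_right
  have hIU : (A ∩ B) * (A ∪ B) ⊆ A * B := by
    rintro _ ⟨x, hx, y, hy, rfl⟩
    rcases hy with hy | hy
    · exact ⟨y, hy, x, hx.2, mul_comm _ _⟩
    · exact ⟨x, hx.1, y, hy, rfl⟩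
  have hcardIU : (A ∩ B).ncard + (A ∪ B).ncard = A.ncard + B.ncard := by
    rw [add_comm]; exact Set.ncard_union_add_ncard_inter A B
  let conv : Subgroup G → Set G → Prop := fun K C => C.Nonempty ∧ C ⊆ A * B ∧
    C * (K : Set G) = C ∧ (A ∩ B).ncard + ((A ∪ B) * (K : Set G)).ncard ≤ C.ncard + Nat.card K
  have hex : ∃ n, ∃ K C, conv K C ∧ Nat.card K = n := by
    obtain ⟨H, h1, h2⟩ := ih (A ∩ B) (A ∪ B) hI (hA.mono Set.subset_union_left) (by
      have h3 := Set.ncard_le_ncard hIU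
      have h4 : (A ∩ B).ncard < A.ncard := Set.ncard_lt_ncard
        ⟨Set.inter_subset_left, fun h => hne fun x hx => (h hx).2⟩
      unfold KLess; omega)
    refine ⟨_, H, (A ∩ B) * (A ∪ B), ⟨hI.mul (hA.mono Set.subset_union_left), hIU, h1, ?_⟩, rfl⟩
    have := Set.ncard_le_ncard (subset_mul_sub (A ∩ B) H)
    omega
  obtain ⟨K, C, ⟨hC0, hCA, hCK, hC⟩, hKn⟩ := Nat.find_spec hex
  have hmin : ∀ K' C', conv K' C' → Nat.card K ≤ Nat.card K' := fun K' C' h => by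
    rw [hKn]; exact Nat.find_min' hex ⟨K', C', h, rfl⟩
  by_cases hper : A * B * (K : Set G) = A * B
  · have hprod : (A * (K : Set G)) * (B * (K : Set G)) = A * B := by
      rw [mul_mul_mul_comm, sub_mul_sub, hper]
    have sA := subset_mul_sub A K
    have sB := subset_mul_sub B K
    by_cases hAB : A * (K : Set G) = A ∧ B * (K : Set G) = B
    · refine ⟨K, hper, ?_⟩
      have h1 := Set.ncard_le_ncard hCA
      have h2 := Set.ncard_le_ncard (subset_mul_sub (A ∪ B) K)
      rw [hAB.1, hAB.2]
      omega
    · obtain ⟨H, h1, h2⟩ := ih (A * K) (B * K) (hA.mono sA) (hB.mono sB) (by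
        have h3 := Set.ncard_le_ncard sA
        have h4 := Set.ncard_le_ncard sB
        have : A.ncard + B.ncard < (A * (K : Set G)).ncard + (B * (K : Set G)).ncard := by
          by_contra hcon
          apply hAB
          constructor
          · exact (Set.eq_of_subset_of_ncard_le sA (by omega)).symm
          · exact (Set.eq_of_subset_of_ncard_le sB (by omega)).symm
        right; left
        rw [hprod]; exact ⟨rfl, this⟩)
      rw [hprod] at h1 h2
      refine ⟨H, h1, ?_⟩
      have h3 := Set.ncard_le_ncard (Set.mul_subset_mul_right (t := (H : Set G)) sA)
      have h4 := Set.ncard_le_ncard (Set.mul_subset_mul_right (t := (H : Set G)) sB)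
      omega
  exfalso
  obtain ⟨a, ha, b, hb, w, hwz, hwA⟩ : ∃ a ∈ A, ∃ b ∈ B, ∃ w ∈ (a * b) • (K : Set G),
      w ∉ A * B := by
    by_contra hcon
    push Not at hcon
    apply hper
    apply Set.Subset.antisymm _ (subset_mul_sub _ _)
    rintro _ ⟨_, ⟨a, ha, b, hb, rfl⟩, k, hk, rfl⟩
    exact hcon a ha b hb _ ⟨k, hk, rfl⟩
  have hCz : Disjoint C ((a * b) • (K : Set G)) := by
    rw [Set.disjoint_left]
    intro x hx hxz
    apply hwA
    apply hCA
    rw [← hCK]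
    refine ⟨x, hx, x⁻¹ * w, ?_, by simp⟩
    have := K.mul_mem (K.inv_mem (mem_coset.1 hxz)) (mem_coset.1 hwz)
    simpa [mul_assoc] using this
  have star : ∀ (D : Set G) (H : Subgroup G), D ⊆ (a * b) • (K : Set G) → D ⊆ A * B →
      D * (H : Set G) = D → H ≤ K → Nat.card H < Nat.card K →
      ((A ∪ B) * (K : Set G)).ncard + D.ncard + Nat.card H <
        ((A ∪ B) * (H : Set G)).ncard + Nat.card K := by
    intro D H hDz hDA hDH hHK hlt
    by_contra hcon
    have hd : (C ∪ D).ncard = C.ncard + D.ncard :=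
      Set.ncard_union_eq (hCz.mono_right hDz)
    have := hmin H (C ∪ D) ⟨hC0.mono Set.subset_union_left, Set.union_subset hCA hDA, ?_, ?_⟩
    · omega
    · rw [Set.union_mul, hDH]
      congr 1
      apply Set.Subset.antisymm _ (subset_mul_sub _ _)
      conv_rhs => rw [← hCK]
      exact Set.mul_subset_mul_left hHK
    · omega
  have mulz : ∀ {x y : G}, x ∈ a • (K : Set G) → y ∈ b • (K : Set G) →
      x * y ∈ (a * b) • (K : Set G) := by
    intro x y hx hy
    rw [mem_coset] at *
    have := K.mul_mem hx hy
    rwa [mul_mul_mul_comm, ← mul_inv] at this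
  -- sizes
  have size1 : ∀ (H : Subgroup G), H ≤ K → ∀ c ∈ A ∪ B,
      ((A ∪ B) * (H : Set G)).ncard + ((c • (K : Set G)) \ ((A ∪ B) * (H : Set G))).ncard ≤
        ((A ∪ B) * (K : Set G)).ncard := by
    intro H hHK c hc
    rw [← Set.ncard_union_eq Set.disjoint_sdiff_right]
    exact Set.ncard_le_ncard (Set.union_subset (Set.mul_subset_mul_left hHK)
      (Set.sdiff_subset.trans (coset_sub hc)))
  have haU : a ∈ A ∪ B := Or.inl ha
  have hbU : b ∈ A ∪ B := Or.inr hb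
  have haK : a ∈ a • (K : Set G) := ⟨1, K.one_mem, mul_one a⟩
  have hbK : b ∈ b • (K : Set G) := ⟨1, K.one_mem, mul_one b⟩
  -- general step for pairs inside cosets
  have step : ∀ X Y : Set G, X.Nonempty → Y.Nonempty → X * Y ⊆ A * B →
      X * Y ⊆ (a * b) • (K : Set G) → ∃ H : Subgroup G, X * Y * (H : Set G) = X * Y ∧
      (X * (H : Set G)).ncard + (Y * (H : Set G)).ncard ≤ (X * Y).ncard + Nat.card H ∧
      H ≤ K ∧ Nat.card H < Nat.card K := by
    intro X Y hX hY hXY hXYz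
    obtain ⟨H, h1, h2⟩ := ih X Y hX hY (Or.inl (Set.ncard_lt_ncard ⟨hXY, fun h => by
      obtain ⟨c, hc⟩ := hC0
      exact Set.disjoint_left.1 hCz hc (hXYz (h (hCA hc)))⟩))
    exact ⟨H, h1, h2, period_props (hX.mul hY) hXYz h1 hXY hwz hwA⟩
  have hD1A : (A ∩ a • (K : Set G)) * (B ∩ b • (K : Set G)) ⊆ A * B :=
    Set.mul_subset_mul Set.inter_subset_left Set.inter_subset_left
  have hD1z : (A ∩ a • (K : Set G)) * (B ∩ b • (K : Set G)) ⊆ (a * b) • (K : Set G) := by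
    rintro _ ⟨x, hx, y, hy, rfl⟩; exact mulz hx.2 hy.2
  have hD2A : (A ∩ b • (K : Set G)) * (B ∩ a • (K : Set G)) ⊆ A * B :=
    Set.mul_subset_mul Set.inter_subset_left Set.inter_subset_left
  have hD2z : (A ∩ b • (K : Set G)) * (B ∩ a • (K : Set G)) ⊆ (a * b) • (K : Set G) := by
    rintro _ ⟨x, hx, y, hy, rfl⟩
    show x * y ∈ _
    rw [mul_comm x y]; exact mulz hy.2 hx.2
  obtain ⟨H1, p1, e1, hH1, hlt1⟩ := step (A ∩ a • (K : Set G)) (B ∩ b • (K : Set G))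
    ⟨a, ha, haK⟩ ⟨b, hb, hbK⟩ hD1A hD1z
  have s1 := star _ H1 hD1z hD1A p1 hH1 hlt1
  have c1a := coset_part A B K H1 hH1 a
  have c1b := coset_part A B K H1 hH1 b
  have z1a := size1 H1 hH1 a haU
  have z1b := size1 H1 hH1 b hbU
  by_cases hB2 : (B ∩ a • (K : Set G)).Nonempty
  swap
  · rw [Set.not_nonempty_iff_eq_empty] at hB2
    rw [hB2, Set.empty_mul, Set.ncard_empty] at c1a
    omega
  by_cases hA2 : (A ∩ b • (K : Set G)).Nonempty
  swap
  · rw [Set.not_nonempty_iff_eq_empty] at hA2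
    rw [hA2, Set.empty_mul, Set.ncard_empty] at c1b
    omega
  by_cases hab : Disjoint (a • (K : Set G)) (b • (K : Set G))
  swap
  · have : a • (K : Set G) = b • (K : Set G) := by
      rw [Set.not_disjoint_iff] at hab
      obtain ⟨x, hx, hy⟩ := hab
      rw [mem_coset] at hx hy
      have hk : a⁻¹ * b ∈ K := by
        have := K.mul_mem hx (K.inv_mem hy)
        simpa [mul_assoc] using this
      exact (leftCoset_eq_iff K).2 hk
    rw [this] at c1a z1a s1 e1
    omega
  obtain ⟨H2, p2, e2, hH2, hlt2⟩ := step _ _ hA2 hB2 hD2A hD2z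
  have h01 : H1 ⊓ H2 ≤ H1 := inf_le_left
  have h02 : H1 ⊓ H2 ≤ H2 := inf_le_right
  have h0K : H1 ⊓ H2 ≤ K := h01.trans hH1
  have c0a := coset_part A B K (H1 ⊓ H2) h0K a
  have c0b := coset_part A B K (H1 ⊓ H2) h0K b
  set A1 := A ∩ a • (K : Set G)
  set B1 := B ∩ b • (K : Set G)
  set A2 := A ∩ b • (K : Set G)
  set B2 := B ∩ a • (K : Set G)
  have pmono : ∀ (D : Set G) (H H' : Subgroup G), H' ≤ H → D * (H : Set G) = D →
      D * (H' : Set G) = D := by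
    intro D H H' hle hD
    apply Set.Subset.antisymm _ (subset_mul_sub _ _)
    conv_rhs => rw [← hD]
    exact Set.mul_subset_mul_left hle
  have s0 := star (A1 * B1 ∪ A2 * B2) (H1 ⊓ H2) (Set.union_subset hD1z hD2z)
    (Set.union_subset hD1A hD2A)
    (by rw [Set.union_mul, pmono _ _ _ h01 p1, pmono _ _ _ h02 p2]) h0K
    (lt_of_le_of_lt (Nat.card_mono (Set.toFinite _) h01) hlt1)
  have z0 : ((A ∪ B) * ((H1 ⊓ H2 : Subgroup G) : Set G)).ncard +
      (((a • (K : Set G)) \ ((A ∪ B) * ((H1 ⊓ H2 : Subgroup G) : Set G))).ncard +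
      ((b • (K : Set G)) \ ((A ∪ B) * ((H1 ⊓ H2 : Subgroup G) : Set G))).ncard) ≤
        ((A ∪ B) * (K : Set G)).ncard := by
    rw [← Set.ncard_union_eq (hab.mono Set.sdiff_subset Set.sdiff_subset), ← Set.union_sdiff_distrib,
      ← Set.ncard_union_eq Set.disjoint_sdiff_right]
    exact Set.ncard_le_ncard (Set.union_subset (Set.mul_subset_mul_left h0K)
      (Set.sdiff_subset.trans (Set.union_subset (coset_sub haU) (coset_sub hbU))))
  have m : ∀ (X : Set G) (H H' : Subgroup G), H' ≤ H →
      (X * (H' : Set G)).ncard ≤ (X * (H : Set G)).ncard := fun X H H' h =>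
    Set.ncard_le_ncard (Set.mul_subset_mul_left h)
  have m1 := m A1 _ _ h01
  have m2 := m B1 _ _ h01
  have m3 := m A2 _ _ h02
  have m4 := m B2 _ _ h02
  have u1 := Set.ncard_union_add_ncard_inter (A1 * B1) (A2 * B2)
  have fin : (A1 * B1 ∩ (A2 * B2)).ncard + (w • (H1 : Set G) ∪ w • (H2 : Set G)).ncard
      ≤ Nat.card K := by
    rw [← Set.ncard_union_eq, ← ncard_smul_sub (a * b) K]
    · refine Set.ncard_le_ncard ?_ (Set.toFinite _)
      have aux : ∀ H : Subgroup G, H ≤ K → w • (H : Set G) ⊆ (a * b) • (K : Set G) := by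
        rintro H hH _ ⟨x, hx, rfl⟩
        rw [mem_coset] at hwz ⊢
        have := K.mul_mem hwz (hH hx)
        simpa [mul_assoc] using this
      exact Set.union_subset (Set.inter_subset_left.trans hD1z)
        (Set.union_subset (aux _ hH1) (aux _ hH2))
    · have aux : ∀ (H : Subgroup G) (D : Set G), D * (H : Set G) = D → D ⊆ A * B →
          ∀ x ∈ D, x ∉ w • (H : Set G) := by
        intro H D hD hDA x hx hxw
        apply hwA
        apply hDA
        rw [← hD]
        refine ⟨x, hx, x⁻¹ * w, ?_, by simp⟩
        have := H.inv_mem (mem_coset.1 hxw)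
        simpa using this
      rw [Set.disjoint_left]
      rintro x ⟨hx1, hx2⟩ (hx | hx)
      · exact aux H1 _ p1 hD1A x hx1 hx
      · exact aux H2 _ p2 hD2A x hx2 hx
  have u2 := Set.ncard_union_add_ncard_inter (w • (H1 : Set G)) (w • (H2 : Set G))
  rw [← Set.smul_set_inter, ← Subgroup.coe_inf, ncard_smul_sub, ncard_smul_sub, ncard_smul_sub] at u2
  omega

lemma KP_smul (A B : Set G) (g : G) (h : KP A (g • B)) : KP A B := by
  obtain ⟨H, h1, h2⟩ := h
  refine ⟨H, ?_, ?_⟩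
  · rw [mul_smul_comm, smul_mul_assoc] at h1
    exact smul_left_cancel g h1
  · rwa [mul_smul_comm, smul_mul_assoc, Set.ncard_smul_set, Set.ncard_smul_set] at h2

lemma kneser_aux (n1 n2 n3 : ℕ) (A B : Set G) (hA : A.Nonempty) (hB : B.Nonempty)
    (e1 : (A * B).ncard = n1) (e2 : 2 * Nat.card G - (A.ncard + B.ncard) = n2)
    (e3 : A.ncard = n3) : KP A B := by
  by_cases hg : ∃ g : G, (A ∩ g • B).Nonempty ∧ ¬ A ⊆ g • B
  · obtain ⟨g, hg1, hg2⟩ := hg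
    apply KP_smul A B g
    apply kneser_core A (g • B) hg1 hg2
    intro A' B' hA' hB' hless
    have l1 : A'.ncard ≤ Nat.card G := Set.ncard_le_card _
    have l2 : B'.ncard ≤ Nat.card G := Set.ncard_le_card _
    unfold KLess at hless
    rw [mul_smul_comm, Set.ncard_smul_set, Set.ncard_smul_set] at hless
    have l3 : A.ncard ≤ Nat.card G := Set.ncard_le_card _
    have l4 : B.ncard ≤ Nat.card G := Set.ncard_le_card _
    have hdec : (A' * B').ncard < n1 ∨ ((A' * B').ncard = n1 ∧
      (2 * Nat.card G - (A'.ncard + B'.ncard) < n2 ∨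
        (2 * Nat.card G - (A'.ncard + B'.ncard) = n2 ∧ A'.ncard < n3))) := by omega
    exact kneser_aux (A' * B').ncard (2 * Nat.card G - (A'.ncard + B'.ncard)) A'.ncard A' B'
      hA' hB' rfl rfl rfl
  · push Not at hg
    obtain ⟨a, ha⟩ := hA
    have key : ∀ a ∈ A, ∀ a' ∈ A, ∀ b ∈ B, a⁻¹ * a' * b ∈ B := by
      intro a ha a' ha' b hb
      have := hg (a * b⁻¹) ⟨a, ha, b, hb, by simp⟩ ha'
      rw [Set.mem_smul_set_iff_inv_smul_mem] at this
      convert this using 1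
      simp [mul_comm, mul_left_comm]
    have hst : ∀ x ∈ A, a⁻¹ * x ∈ MulAction.stabilizer G B := by
      intro x hx
      rw [MulAction.mem_stabilizer_iff]
      refine Set.eq_of_subset_of_ncard_le ?_ (by rw [Set.ncard_smul_set])
      rintro _ ⟨b, hb, rfl⟩
      exact key a ha x hx b hb
    have hBH : B * (MulAction.stabilizer G B : Set G) = B := MulAction.mul_stabilizer_self B
    have hAH : A * (MulAction.stabilizer G B : Set G) ⊆
        a • (MulAction.stabilizer G B : Set G) := by
      rintro _ ⟨x, hx, y, hy, rfl⟩
      rw [mem_coset]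
      have := (MulAction.stabilizer G B).mul_mem (hst x hx) hy
      simpa [mul_assoc] using this
    refine ⟨MulAction.stabilizer G B, by rw [mul_assoc, hBH], ?_⟩
    rw [hBH]
    have h1 := Set.ncard_le_ncard hAH
    rw [ncard_smul_sub] at h1
    have h2 : B.ncard ≤ (A * B).ncard := by
      rw [← Set.ncard_smul_set a B]
      refine Set.ncard_le_ncard ?_
      rintro _ ⟨b, hb, rfl⟩
      exact ⟨a, ha, b, hb, rfl⟩
    omega
termination_by (n1, n2, n3)
decreasing_by
  simp only [Prod.lex_def]
  exact hdec

lemma kneser (A B : Set G) (hA : A.Nonempty) (hB : B.Nonempty) : KP A B :=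
  kneser_aux _ _ _ A B hA hB rfl rfl rfl

/-- Version with a prescribed subgroup containing all periods. -/
lemma kneser_step (A B : Set G) (hA : A.Nonempty) (hB : B.Nonempty) (S : Subgroup G)
    (hS : ∀ H : Subgroup G, A * B * (S : Set G) * (H : Set G) = A * B * (S : Set G) → H ≤ S) :
    (A * (S : Set G)).ncard + (B * (S : Set G)).ncard ≤
      (A * B * (S : Set G)).ncard + Nat.card S := by
  obtain ⟨H, h1, h2⟩ := kneser (A * (S : Set G)) (B * (S : Set G))
    (hA.mono (subset_mul_sub A S)) (hB.mono (subset_mul_sub B S))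
  rw [mul_mul_mul_comm, sub_mul_sub] at h1 h2
  have h3 := hS H h1
  have h4 : Nat.card H ≤ Nat.card S := Nat.card_mono (Set.toFinite _) h3
  have h5 := Set.ncard_le_ncard (subset_mul_sub (A * (S : Set G)) H)
  have h6 := Set.ncard_le_ncard (subset_mul_sub (B * (S : Set G)) H)
  omega

lemma dvd_ncard (X : Set G) (S : Subgroup G) : Nat.card S ∣ (X * (S : Set G)).ncard := by
  rw [← QuotientGroup.preimage_image_mk_eq_mul]
  have := Nat.card_congr (QuotientGroup.preimageMkEquivSubgroupProdSet S
    ((QuotientGroup.mk : G → G ⧸ S) '' X))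
  rw [Nat.card_prod] at this
  exact ⟨_, this⟩

lemma six_sets (h : ℕ) (hN : Nat.card G = 6 * h + 1)
    (hdiv : ∀ s, s ∣ 6 * h + 1 → s % 6 = 1) (A1 A2 A3 A4 A5 A6 : Set G)
    (h1 : A1.ncard = 2 * h) (h2 : A2.ncard = h) (h3 : A3.ncard = h) (h4 : A4.ncard = h)
    (h5 : A5.ncard = h) (h6 : A6.ncard = 6) (hh : 0 < h) (x : G)
    (hx : x ∉ A1 * A2 * A3 * A4 * A5 * A6) : False := by
  have n1 : A1.Nonempty := by rw [← Set.ncard_pos]; omega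
  have n2 : A2.Nonempty := by rw [← Set.ncard_pos]; omega
  have n3 : A3.Nonempty := by rw [← Set.ncard_pos]; omega
  have n4 : A4.Nonempty := by rw [← Set.ncard_pos]; omega
  have n5 : A5.Nonempty := by rw [← Set.ncard_pos]; omega
  have n6 : A6.Nonempty := by rw [← Set.ncard_pos]; omega
  set T := A1 * A2 * A3 * A4 * A5 * A6 with hT
  set S := MulAction.stabilizer G T with hSdef
  have hTS : T * (S : Set G) = T := MulAction.mul_stabilizer_self T
  have hmax : ∀ H : Subgroup G, T * (H : Set G) = T → H ≤ S := by
    intro H hH y hy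
    rw [hSdef, MulAction.mem_stabilizer_iff]
    refine Set.eq_of_subset_of_ncard_le ?_ (by rw [Set.ncard_smul_set])
    rintro _ ⟨t, ht, rfl⟩
    rw [← hH]
    exact ⟨t, ht, y, hy, mul_comm _ _⟩
  have hmax' : ∀ X Y : Set G, X * Y = T → ∀ H : Subgroup G,
      X * (S : Set G) * (H : Set G) = X * (S : Set G) → H ≤ S := by
    intro X Y hXY H hH
    apply hmax
    have : T = X * (S : Set G) * Y := by rw [mul_right_comm, hXY, hTS]
    rw [this, mul_right_comm, hH]
  have k1 := kneser_step A1 A2 n1 n2 S (hmax' _ (A3 * A4 * A5 * A6) (by simp only [hT, mul_assoc]))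
  have k2 := kneser_step _ A3 (n1.mul n2) n3 S
    (hmax' _ (A4 * A5 * A6) (by simp only [hT, mul_assoc]))
  have k3 := kneser_step _ A4 ((n1.mul n2).mul n3) n4 S
    (hmax' _ (A5 * A6) (by simp only [hT, mul_assoc]))
  have k4 := kneser_step _ A5 (((n1.mul n2).mul n3).mul n4) n5 S
    (hmax' _ A6 (by simp only [hT, mul_assoc]))
  have k5 := kneser_step _ A6 ((((n1.mul n2).mul n3).mul n4).mul n5) n6 S
    (hmax' _ 1 (by simp only [hT, mul_one]))
  rw [← hT] at k5
  have l : ∀ X : Set G, X.ncard ≤ (X * (S : Set G)).ncard :=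
    fun X => Set.ncard_le_ncard (subset_mul_sub X S)
  have l1 := l A1
  have l2 := l A2
  have l3 := l A3
  have l4 := l A4
  have l5 := l A5
  have l6 := l A6
  have hTlt : (T * (S : Set G)).ncard < Nat.card G := by
    rw [hTS, ← Set.ncard_univ]
    exact Set.ncard_lt_ncard ⟨Set.subset_univ _, fun h => hx (h trivial)⟩
  obtain ⟨c1, d1⟩ := dvd_ncard A1 S
  obtain ⟨c2, d2⟩ := dvd_ncard A2 S
  obtain ⟨c3, d3⟩ := dvd_ncard A3 S
  obtain ⟨c4, d4⟩ := dvd_ncard A4 S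
  obtain ⟨c5, d5⟩ := dvd_ncard A5 S
  obtain ⟨c6, d6⟩ := dvd_ncard A6 S
  obtain ⟨c, d⟩ := dvd_ncard T S
  obtain ⟨m, hm⟩ := Subgroup.card_subgroup_dvd_card S
  have hs6 := hdiv (Nat.card S) ⟨m, by rw [← hN, hm]⟩
  have hm6 := hdiv m ⟨Nat.card S, by rw [← hN, hm, mul_comm]⟩
  have hspos : 0 < Nat.card S := Nat.card_pos
  generalize Nat.card S = s at *
  have tot : s * (c1 + c2 + c3 + c4 + c5 + c6) ≤ s * (c + 5) := by
    simp only [mul_add]; omega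
  have tot' := Nat.le_of_mul_le_mul_left tot hspos
  have hcm : c < m := by
    rw [d, hm] at hTlt
    exact Nat.lt_of_mul_lt_mul_left hTlt
  rw [h1, d1] at l1
  rw [h2, d2] at l2
  rw [h3, d3] at l3
  rw [h4, d4] at l4
  rw [h5, d5] at l5
  rw [h6, d6] at l6
  obtain ⟨u, hu⟩ : ∃ u, s = 6 * u + 1 := ⟨s / 6, by omega⟩
  obtain ⟨v, hv⟩ : ∃ v, m = 6 * v + 1 := ⟨m / 6, by omega⟩
  have hhv : h = s * v + u := by
    have : 6 * h + 1 = s * m := by rw [← hN, hm]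
    rw [hv] at this
    have e : s * (6 * v + 1) = 6 * (s * v) + s := by ring
    omega
  rcases Nat.eq_zero_or_pos u with hu0 | hu0
  · subst hu0
    have : s = 1 := by omega
    subst this
    omega
  · have low : ∀ cc, h ≤ s * cc → v + 1 ≤ cc := by
      intro cc hcc
      have : s * v < s * cc := by omega
      exact Nat.lt_of_mul_lt_mul_left this
    have low1 : 2 * v + 1 ≤ c1 := by
      have : s * (2 * v) < s * c1 := by
        have e : s * (2 * v) = 2 * (s * v) := by ring
        omega
      exact Nat.lt_of_mul_lt_mul_left this
    have := low _ l2
    have := low _ l3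
    have := low _ l4
    have := low _ l5
    have : 0 < c6 := by
      rcases Nat.eq_zero_or_pos c6 with h0 | h0
      · subst h0; simp at l6
      · exact h0
    omega

end Kneser

lemma div_mod_six (k : ℕ) : ∀ s, s ∣ 2 ^ (3 ^ k) - 1 → s % 6 = 1 := by
  have hp : ∀ p, p.Prime → p ∣ 2 ^ (3 ^ k) - 1 → p % 6 = 1 := by
    intro p hp hd
    have := Fact.mk hp
    have h2 : (2 : ZMod p) ^ (3 ^ k) = 1 := by
      have := (ZMod.natCast_eq_zero_iff (2 ^ (3 ^ k) - 1) p).2 hd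
      rw [Nat.cast_sub Nat.one_le_two_pow] at this
      push_cast at this
      exact sub_eq_zero.1 this
    have hodd : p ≠ 2 := by
      rintro rfl
      have h3 : (2 : ZMod 2) = 0 := rfl
      rw [h3, zero_pow (by positivity)] at h2
      exact zero_ne_one h2
    have hord := orderOf_dvd_of_pow_eq_one h2
    obtain ⟨j, hj, hje⟩ := (Nat.dvd_prime_pow Nat.prime_three).1 hord
    have hne : (2 : ZMod p) ≠ 0 := by
      intro h0
      rw [h0, zero_pow (by positivity)] at h2
      exact zero_ne_one h2
    have hdvd := orderOf_dvd_of_pow_eq_one (ZMod.pow_card_sub_one_eq_one hne)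
    have hj0 : j ≠ 0 := by
      rintro rfl
      rw [pow_zero, orderOf_eq_one_iff] at hje
      have h4 : (1 : ZMod p) + 1 = 1 + 0 := by rw [add_zero, one_add_one_eq_two, hje]
      exact one_ne_zero (add_left_cancel h4)
    have h3 : 3 ∣ p - 1 := (dvd_pow_self 3 hj0).trans (hje ▸ hdvd)
    have := hp.eq_two_or_odd
    have := hp.two_le
    omega
  intro s
  induction s using Nat.recOnMul with
  | zero =>
    intro h
    rw [zero_dvd_iff] at h
    have : 2 ^ 1 ≤ 2 ^ (3 ^ k) := Nat.pow_le_pow_right (by norm_num) (Nat.one_le_pow _ _ (by norm_num))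
    omega
  | one => intro _; rfl
  | prime p h => exact hp p h
  | mul a b ha hb =>
    intro h
    rw [Nat.mul_mod, ha (dvd_of_mul_right_dvd h), hb (dvd_of_mul_left_dvd h)]


lemma realizable_of_exp (F : Type) [Field F] [Fintype F] (d : Fin 6 → ℕ) (f : Fin 6 → ℕ → ℕ)
    (w : ℕ) (hinj : ∀ i, Set.InjOn (f i) (Finset.range (d i)))
    (hlt : ∀ i, ∀ j < d i, f i j < Fintype.card F - 1)
    (hno : ∀ j : Fin 6 → ℕ, (∀ i, j i < d i) → ¬ (Fintype.card F - 1 ∣ w + ∑ i, f i (j i))) :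
    Realizable F 6 d := by
  classical
  obtain ⟨g, hg⟩ := IsCyclic.exists_generator (α := Fˣ)
  have hord : orderOf g = Fintype.card F - 1 := by
    rw [orderOf_eq_card_of_forall_mem_zpowers hg, Nat.card_eq_fintype_card, Fintype.card_units]
  let u : Fin 6 → Fˣ := fun i => if i = 0 then -g ^ w else 1
  refine ⟨fun i => (Finset.range (d i)).image fun j => ((u i * g ^ (f i j) : Fˣ) : F), ?_, ?_, ?_⟩
  · intro i h
    rw [Finset.mem_image] at h
    obtain ⟨j, _, h⟩ := h
    exact Units.ne_zero _ h
  · intro i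
    rw [Finset.card_image_of_injOn, Finset.card_range]
    intro x hx y hy hxy
    have h1 := mul_left_cancel (Units.ext hxy)
    apply hinj i hx hy
    refine pow_injOn_Iio_orderOf (x := g) ?_ ?_ h1
    · rw [hord]; exact hlt i x (by simpa using hx)
    · rw [hord]; exact hlt i y (by simpa using hy)
  · intro a ha heq
    simp only [Finset.mem_image, Finset.mem_range] at ha
    choose j hj hja using ha
    apply hno j hj
    rw [← hord, orderOf_dvd_iff_pow_eq_one]
    have h1 : ∏ i, a i = ((∏ i, (u i * g ^ (f i (j i))) : Fˣ) : F) := by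
      rw [Units.coe_prod]; exact Finset.prod_congr rfl fun i _ => (hja i).symm
    have h2 : ∏ i, (u i * g ^ (f i (j i))) = - g ^ (w + ∑ i, f i (j i)) := by
      rw [Finset.prod_mul_distrib, Finset.prod_pow_eq_pow_sum, Finset.prod_ite_eq' Finset.univ 0,
        if_pos (Finset.mem_univ _), pow_add, neg_mul]
    rw [h1, h2, Units.val_neg] at heq
    have h3 : ((-1 : F)) ^ (6 - 1) = -1 := by norm_num
    rw [h3, neg_inj] at heq
    exact Units.ext heq.symm

lemma realizable_large (h : ℕ) (F : Type) [Field F] [Fintype F]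
    (hF : 6 * h + 2 < Fintype.card F) (hh : 6 ≤ h) : Realizable F 6 ![2 * h, h, h, h, h, 6] := by
  refine realizable_of_exp F _ (fun _ j => j) (Fintype.card F - 1 - (6 * h + 1)) ?_ ?_ ?_
  · intro i; exact Function.injective_id.injOn
  · intro i j hj
    fin_cases i <;> simp at hj ⊢ <;> omega
  · intro j hj hd
    have h0 := hj 0
    have h1 := hj 1
    have h2 := hj 2
    have h3 := hj 3
    have h4 := hj 4
    have h5 := hj 5
    simp at h0 h1 h2 h3 h4 h5
    rw [Fin.sum_univ_six] at hd
    have := Nat.le_of_dvd (by omega) hd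
    omega

lemma realizable_q (h : ℕ) (F : Type) [Field F] [Fintype F]
    (hF : Fintype.card F = 3 * h + 1) (hh : 6 ≤ h) : Realizable F 6 ![2 * h, h, h, h, h, 6] := by
  refine realizable_of_exp F _
    (fun i j => if i = 0 then 3 * (j / 2) + 1 + j % 2 else 3 * j) 0 ?_ ?_ ?_
  · intro i x _ y _ hxy
    dsimp only at hxy
    split_ifs at hxy <;> omega
  · intro i j hj
    rw [hF]
    fin_cases i <;> simp at hj ⊢ <;> omega
  · intro j hj hd
    rw [hF, Fin.sum_univ_six] at hd
    simp at hd
    have := (Dvd.intro h rfl : 3 ∣ 3 * h).trans hd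
    omega

lemma not_realizable_small (h : ℕ) (F : Type) [Field F] [Fintype F]
    (hF : Fintype.card F < 3 * h + 1) (hh : 6 ≤ h) :
    ¬ Realizable F 6 ![2 * h, h, h, h, h, 6] := by
  classical
  rintro ⟨S, h0, hc, hp⟩
  have hne : ∀ i, (S i).Nonempty := by
    intro i
    rw [← Finset.card_pos, hc]
    fin_cases i <;> simp <;> omega
  choose b hb using hne
  have hbne : ∀ i, b i ≠ 0 := fun i h => h0 i (h ▸ hb i)
  have hS : ∀ i, ∀ x ∈ S i, x ≠ 0 := fun i x hx h => h0 i (h ▸ hx)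
  let c : F := -(b 2 * b 3 * b 4 * b 5)⁻¹
  have hprod0 : b 2 * b 3 * b 4 * b 5 ≠ 0 := by simp [hbne]
  have hcne : c ≠ 0 := by simp [c, hbne]
  have hnd : ¬ Disjoint (S 0) ((S 1).image fun x => c * x⁻¹) := by
    intro hd
    have h1 := Finset.card_union_of_disjoint hd
    have h2 : ((S 1).image fun x => c * x⁻¹).card = (S 1).card := by
      apply Finset.card_image_of_injective
      intro x y hxy
      exact inv_injective (mul_left_cancel₀ hcne hxy)
    have h3 : S 0 ∪ ((S 1).image fun x => c * x⁻¹) ⊆ Finset.univ.erase 0 := by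
      intro x hx
      rw [Finset.mem_erase]
      refine ⟨?_, Finset.mem_univ _⟩
      rcases Finset.mem_union.1 hx with hx | hx
      · exact hS 0 x hx
      · obtain ⟨y, hy, rfl⟩ := Finset.mem_image.1 hx
        exact mul_ne_zero hcne (inv_ne_zero (hS 1 y hy))
    have h4 := Finset.card_le_card h3
    rw [Finset.card_erase_of_mem (Finset.mem_univ _), Finset.card_univ, h1, h2, hc, hc] at h4
    have : 0 < Fintype.card F := Fintype.card_pos
    simp at h4
    omega
  rw [Finset.not_disjoint_iff] at hnd
  obtain ⟨x, hx, hx'⟩ := hnd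
  obtain ⟨y, hy, hxy⟩ := Finset.mem_image.1 hx'
  apply hp ![x, y, b 2, b 3, b 4, b 5]
  · intro i
    fin_cases i
    · exact hx
    · exact hy
    · exact hb 2
    · exact hb 3
    · exact hb 4
    · exact hb 5
  · rw [Fin.prod_univ_six]
    show _ = x * y * b 2 * b 3 * b 4 * b 5
    have hy0 := hS 1 y hy
    have e : x * y = c := by rw [← hxy]; field_simp
    have e2 : x * y * b 2 * b 3 * b 4 * b 5 = c * (b 2 * b 3 * b 4 * b 5) := by rw [e]; ring
    rw [e2]
    simp only [c, neg_mul, inv_mul_cancel₀ hprod0]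
    norm_num

lemma not_realizable_q' (h : ℕ) (hdiv : ∀ s, s ∣ 6 * h + 1 → s % 6 = 1)
    (F : Type) [Field F] [Fintype F]
    (hF : Fintype.card F = 6 * h + 2) (hh : 6 ≤ h) :
    ¬ Realizable F 6 ![2 * h, h, h, h, h, 6] := by
  classical
  rintro ⟨S, h0, hc, hp⟩
  have hcard : Nat.card Fˣ = 6 * h + 1 := by
    rw [Nat.card_eq_fintype_card, Fintype.card_units, hF]; rfl
  let A : Fin 6 → Set Fˣ := fun i => {u | (u : F) ∈ S i}
  have hA : ∀ i, (A i).ncard = (S i).card := by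
    intro i
    rw [← Set.ncard_coe_finset, ← Set.ncard_image_of_injective (A i) Units.val_injective]
    congr 1
    ext x
    constructor
    · rintro ⟨u, hu, rfl⟩; exact hu
    · intro hx
      have hx0 : x ≠ 0 := fun h => h0 i (h ▸ hx)
      exact ⟨Units.mk0 x hx0, hx, rfl⟩
  refine six_sets h hcard hdiv (A 0) (A 1) (A 2) (A 3) (A 4) (A 5)
    (by rw [hA, hc]; rfl) (by rw [hA, hc]; rfl) (by rw [hA, hc]; rfl) (by rw [hA, hc]; rfl)
    (by rw [hA, hc]; rfl) (by rw [hA, hc]; rfl) (by omega) (-1) ?_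
  rintro ⟨_, ⟨_, ⟨_, ⟨_, ⟨x0, m0, x1, m1, rfl⟩, x2, m2, rfl⟩, x3, m3, rfl⟩, x4, m4, rfl⟩,
    x5, m5, he⟩
  apply hp ![(x0 : F), x1, x2, x3, x4, x5]
  · intro i
    fin_cases i
    · exact m0
    · exact m1
    · exact m2
    · exact m3
    · exact m4
    · exact m5
  · rw [Fin.prod_univ_six]
    show _ = (x0 : F) * x1 * x2 * x3 * x4 * x5
    have := congrArg (Units.val) he
    simp only [Units.val_mul, Units.val_neg, Units.val_one] at this
    rw [this]; norm_num

theorem gap_qmin_qmax_unbounded (M : ℕ) (hM : 0 < M) :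
    ∃ q q' : ℕ, (∃ a : ℕ, 1 ≤ a ∧ q = 2 ^ a) ∧ (∃ b : ℕ, 1 ≤ b ∧ q' = 2 ^ b) ∧
      q < q' ∧ M ≤ q' - q ∧
      ∃ ω : ℕ, 3 ≤ ω ∧ ∃ d : Fin ω → ℕ, (∀ i, 2 ≤ d i) ∧
        (∀ (F : Type) [Field F] [Fintype F], Fintype.card F = q → Realizable F ω d) ∧
        (∀ (F : Type) [Field F] [Fintype F], Fintype.card F < q → ¬ Realizable F ω d) ∧
        (∀ (F : Type) [Field F] [Fintype F], Fintype.card F = q' → ¬ Realizable F ω d) ∧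
        (∀ (F : Type) [Field F] [Fintype F], q' < Fintype.card F → Realizable F ω d) := by
  obtain ⟨c, hc⟩ : ∃ c, 3 ^ (M + 2) = 2 * c + 1 := by
    have : Odd (3 ^ (M + 2)) := Odd.pow (by decide)
    exact this
  have hMc : M < 3 ^ M := Nat.lt_pow_self (by norm_num)
  have h9 : 3 ^ (M + 2) = 9 * 3 ^ M := by ring
  have hcM : M + 4 ≤ 2 * c := by omega
  have hc4 : 4 ≤ c := by omega
  obtain ⟨h, hh⟩ : ∃ h, 2 ^ (2 * c) = 3 * h + 1 := by
    have h1 : 2 ^ (2 * c) % 3 = 1 := by rw [pow_mul, Nat.pow_mod]; simp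
    exact ⟨2 ^ (2 * c) / 3, by omega⟩
  have hbig : 2 ^ 8 ≤ 2 ^ (2 * c) := Nat.pow_le_pow_right (by norm_num) (by omega)
  have hlt : 2 * c < 2 ^ (2 * c) := Nat.lt_pow_self (by norm_num)
  have hh6 : 6 ≤ h := by omega
  have hq' : 2 ^ (2 * c + 1) = 6 * h + 2 := by rw [pow_succ, hh]; ring
  have hdiv : ∀ s, s ∣ 6 * h + 1 → s % 6 = 1 := by
    intro s hs
    apply div_mod_six (M + 2)
    rw [hc, hq']; exact hs
  refine ⟨3 * h + 1, 6 * h + 2, ⟨2 * c, by omega, hh.symm⟩, ⟨2 * c + 1, by omega, hq'.symm⟩,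
    by omega, by omega, 6, by norm_num, ![2 * h, h, h, h, h, 6], ?_, ?_, ?_, ?_, ?_⟩
  · intro i
    fin_cases i <;> simp <;> omega
  · intro F _ _ hF
    exact realizable_q h F hF hh6
  · intro F _ _ hF
    exact not_realizable_small h F hF hh6
  · intro F _ _ hF
    exact not_realizable_q' h hdiv F hF hh6
  · intro F _ _ hF
    exact realizable_large h F hF hh6
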